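/- arXiv:1302.5808 — 2 statements merged into one kernel-verified Lean document; each statement's English description precedes it below -/
import Mathlib

section
/- Let k ≥ 2. For every sequence (i₁,…,i_{2k−2}) ∈ {1,2}^{2k−2}, the conjugate T_{k,i₁,…,i_{2k−2}} = w⁻¹ T_k w, where w = a_{1,i₁} a_{i₁,i₂} ⋯ a_{i_{2k−3},i_{2k−2}}, satisfies the identity T_{k,i₁,…,i_{2k−2}} = (Δ₃σ₄)² · (∂₃^{−(2(2k−2)+1)}(a_{i_{2k−3},i_{2k−2}})σ₄) ⋯ (∂₃^{−3}(a_{i₁,i₂})σ₄) · (∂₃^{−1}(a_{1,i₁})σ₄) · (δ₃σ₄σ₃σ₄) · (σ₃σ₄a_{1,i₁}) · (σ₄a_{i₁,i₂}) ⋯ (σ₄a_{i_{2k−3},i_{2k−2}}), where ∂₃^{−(2l+1)}(x) denotes Δ₃^{l+1} x⁻¹ Δ₃^{−l}. Moreover each factor in this product is a simple braid distinct from 1 and Δ, and every pair of consecutive factors is left-weighted (so this is the left normal form of T_{k,i₁,…,i_{2k−2}}). -/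
/-- Defining relations of the braid group on 5 strands, as elements of the
free group on four generators (generator `i` corresponds to `σ_{i+1}`). -/
def braidRels : Set (FreeGroup (Fin 4)) :=
  { r | (∃ i : Fin 3, r = FreeGroup.of i.castSucc * FreeGroup.of i.succ * FreeGroup.of i.castSucc *
          (FreeGroup.of i.succ * FreeGroup.of i.castSucc * FreeGroup.of i.succ)⁻¹) ∨
        (∃ i j : Fin 4, 2 ≤ |(i : ℤ) - (j : ℤ)| ∧
          r = FreeGroup.of i * FreeGroup.of j * (FreeGroup.of j * FreeGroup.of i)⁻¹) }

/-- The Artin braid group on 5 strands. -/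
abbrev B5 : Type := PresentedGroup braidRels

/-- The Artin generators (index `i` corresponds to `σ_{i+1}`). -/
def gen (i : Fin 4) : B5 := PresentedGroup.of i

def s1 : B5 := gen 0
def s2 : B5 := gen 1
def s3 : B5 := gen 2
def s4 : B5 := gen 3

/-- A braid is positive if it lies in the submonoid generated by `σ₁,…,σ₄`. -/
def IsPos (x : B5) : Prop := x ∈ Submonoid.closure (Set.range gen)

/-- Prefix order: `Pre x y` means `x ≼ y`, i.e. `x⁻¹ y` is positive. -/
def Pre (x y : B5) : Prop := IsPos (x⁻¹ * y)

/-- The half twist `Δ = σ₁σ₂σ₃σ₄σ₁σ₂σ₃σ₁σ₂σ₁`. -/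
def Δ : B5 := s1*s2*s3*s4*s1*s2*s3*s1*s2*s1

def δ3 : B5 := s2*s1
def Δ3 : B5 := s2*s1*s2
def δt3 : B5 := s1*s2

/-- A braid `s` is simple if `1 ≼ s ≼ Δ`. -/
def IsSimple (s : B5) : Prop := IsPos s ∧ Pre s Δ

/-- Two simple braids `s, t` are left-weighted if no generator `σᵢ` is such that
`s σᵢ` and `σᵢ⁻¹ t` are both simple. -/
def LeftWeighted (s t : B5) : Prop :=
  ¬ ∃ i : Fin 4, IsSimple (s * gen i) ∧ IsSimple ((gen i)⁻¹ * t)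

/-- The canonical length of `z`: the minimum of `q - p` over `p ≤ q` with
`Δ^p ≼ z` and `z ≼ Δ^q`. -/
noncomputable def canLen (z : B5) : ℕ :=
  sInf { n : ℕ | ∃ p q : ℤ, p ≤ q ∧ q - p = (n : ℤ) ∧ Pre (Δ ^ p) z ∧ Pre z (Δ ^ q) }

/-- `y` belongs to the super summit set of `x`:
`y` is conjugate to `x` and has minimal canonical length among conjugates of `x`. -/
def InSSS (x y : B5) : Prop :=
  IsConj x y ∧ ∀ z : B5, IsConj x z → canLen y ≤ canLen z

/-- The braid `T_k = δ₃^{3k+1} σ₄^{2k+2} σ₃ σ₄^{2k-1}`. -/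
def T (k : ℕ) : B5 := δ3 ^ (3*k+1) * s4 ^ (2*k+2) * s3 * s4 ^ (2*k-1)

/-- The braid `T'_k`, a rigid conjugate of `T_k`. -/
def T' (k : ℕ) : B5 :=
  (s1*s3)^(2*k-2) * (s3*s4*Δ3) * (Δ3*s4) * ((δ3*s4)*(δt3*s4))^(k-1) * (δ3*s4*s3*s4)

/-- The four simple 3-braids `a_{1,1}=σ₁`, `a_{1,2}=σ₁σ₂`, `a_{2,1}=σ₂σ₁`, `a_{2,2}=σ₂`
(index `0` stands for `1` and index `1` stands for `2`). -/
def aGen : Fin 2 → Fin 2 → B5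
  | 0, 0 => s1
  | 0, 1 => s1*s2
  | 1, 0 => s2*s1
  | 1, 1 => s2

/-- The `n`-th letter `a_{i_n, i_{n+1}}` of the conjugating word, with the convention
`i₀ = 1` (encoded as `0 : Fin 2`); the sequence `i` is 0-indexed, so `i t` encodes
`i_{t+1}` of the paper. -/
def letter (i : ℕ → Fin 2) (n : ℕ) : B5 :=
  aGen (if n = 0 then 0 else i (n-1)) (i n)

/-- The word `a_{1,i₁} a_{i₁,i₂} ⋯` built from the first `n` letters. -/
def seqWord (i : ℕ → Fin 2) : ℕ → B5
  | 0 => 1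
  | n+1 => seqWord i n * letter i n

/-- The conjugate `T_{k,i₁,…,i_{2k-2}} = w⁻¹ T_k w` where
`w = a_{1,i₁} a_{i₁,i₂} ⋯ a_{i_{2k-3},i_{2k-2}}`. -/
def Tki (k : ℕ) (i : ℕ → Fin 2) : B5 :=
  (seqWord i (2*k-2))⁻¹ * T k * seqWord i (2*k-2)

/-! ### Words and braid moves -/

/-- The braid spelled by a word in the generators. -/
def word (u : List (Fin 4)) : B5 := (u.map gen).prod

@[simp] theorem word_nil : word [] = 1 := rfl

@[simp] theorem word_cons (a : Fin 4) (u : List (Fin 4)) : word (a :: u) = gen a * word u := by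
  simp [word]

theorem word_append (u v : List (Fin 4)) : word (u ++ v) = word u * word v := by
  simp [word]

theorem isPos_gen (a : Fin 4) : IsPos (gen a) := Submonoid.subset_closure ⟨a, rfl⟩

theorem isPos_word (u : List (Fin 4)) : IsPos (word u) :=
  Submonoid.list_prod_mem _ fun x hx => by
    obtain ⟨a, -, rfl⟩ := List.mem_map.1 hx
    exact isPos_gen a

theorem word_congr (u v : List (Fin 4)) {x y a b : List (Fin 4)} (h : word x = word y)
    (ha : a = u ++ x ++ v := by decide) (hb : b = u ++ y ++ v := by decide) :
    word a = word b := by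
  simp only [ha, hb, word_append, h]

theorem gen_comm (i j : Fin 4) (h : 2 ≤ |(i : ℤ) - (j : ℤ)|) :
    gen i * gen j = gen j * gen i := by
  refine mul_inv_eq_one.1 ?_
  exact PresentedGroup.one_of_mem (rels := braidRels) (Or.inr ⟨i, j, h, rfl⟩)

theorem gen_braid (i : Fin 3) :
    gen i.castSucc * gen i.succ * gen i.castSucc = gen i.succ * gen i.castSucc * gen i.succ := by
  refine mul_inv_eq_one.1 ?_
  exact PresentedGroup.one_of_mem (rels := braidRels) (Or.inl ⟨i, rfl⟩)

theorem word_comm (i j : Fin 4) (h : 2 ≤ |(i : ℤ) - (j : ℤ)| := by decide) :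
    word [i, j] = word [j, i] := by
  simpa using gen_comm i j h

theorem word_braid (i j : Fin 4) (h : |(i : ℤ) - (j : ℤ)| = 1 := by decide) :
    word [i, j, i] = word [j, i, j] := by
  have key : ∀ i j : Fin 4, |(i : ℤ) - (j : ℤ)| = 1 →
      ∃ a : Fin 3, (i = a.castSucc ∧ j = a.succ) ∨ (j = a.castSucc ∧ i = a.succ) := by decide
  obtain ⟨a, ⟨rfl, rfl⟩ | ⟨rfl, rfl⟩⟩ := key i j h
  · simpa [mul_assoc] using gen_braid a
  · simpa [mul_assoc] using (gen_braid a).symm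

theorem Δ_eq_word : Δ = word [0, 1, 2, 3, 0, 1, 2, 0, 1, 0] := by
  simp [Δ, s1, s2, s3, s4, mul_assoc]

theorem pre_of_word_append_eq {u v : List (Fin 4)} (h : word (u ++ v) = Δ) : Pre (word u) Δ := by
  rw [Pre, ← h, word_append, inv_mul_cancel_left]
  exact isPos_word v

theorem Pre.word_of_append {u v : List (Fin 4)} {x : B5} (h : Pre (word (u ++ v)) x) :
    Pre (word u) x := by
  have := Submonoid.mul_mem _ (isPos_word v) h
  rwa [word_append, mul_inv_rev, ← mul_assoc, ← mul_assoc, mul_inv_cancel, one_mul] at this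

theorem isSimple_word_of_append {u v w : List (Fin 4)} (h : Pre (word w) Δ)
    (e : word (u ++ v) = word w) : IsSimple (word u) :=
  ⟨isPos_word u, Pre.word_of_append (e ▸ h)⟩

theorem pre_Δ3_mul_s4 : Pre (word [1, 0, 1, 3]) Δ := by
  refine pre_of_word_append_eq (v := [2, 3, 1, 2, 0, 1]) (Eq.symm ?_)
  calc
    Δ = word [0, 1, 2, 3, 0, 1, 2, 0, 1, 0] := Δ_eq_word
    _ = word [0, 1, 2, 0, 3, 1, 2, 0, 1, 0] :=
      word_congr [0, 1, 2] [1, 2, 0, 1, 0] (word_comm 3 0)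
    _ = word [0, 1, 0, 2, 3, 1, 2, 0, 1, 0] :=
      word_congr [0, 1] [3, 1, 2, 0, 1, 0] (word_comm 2 0)
    _ = word [1, 0, 1, 2, 3, 1, 2, 0, 1, 0] :=
      word_congr [] [2, 3, 1, 2, 0, 1, 0] (word_braid 0 1)
    _ = word [1, 0, 1, 2, 3, 1, 2, 1, 0, 1] :=
      word_congr [1, 0, 1, 2, 3, 1, 2] [] (word_braid 0 1)
    _ = word [1, 0, 1, 2, 3, 2, 1, 2, 0, 1] :=
      word_congr [1, 0, 1, 2, 3] [0, 1] (word_braid 1 2)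
    _ = word [1, 0, 1, 3, 2, 3, 1, 2, 0, 1] :=
      word_congr [1, 0, 1] [1, 2, 0, 1] (word_braid 2 3)

theorem pre_δ3_mul_s4_mul_s3_mul_s4 : Pre (word [1, 0, 3, 2, 3]) Δ := by
  refine pre_of_word_append_eq (v := [1, 2, 3, 0, 1]) (Eq.symm ?_)
  calc
    Δ = word [0, 1, 2, 3, 0, 1, 2, 0, 1, 0] := Δ_eq_word
    _ = word [0, 1, 2, 0, 3, 1, 2, 0, 1, 0] :=
      word_congr [0, 1, 2] [1, 2, 0, 1, 0] (word_comm 3 0)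
    _ = word [0, 1, 0, 2, 3, 1, 2, 0, 1, 0] :=
      word_congr [0, 1] [3, 1, 2, 0, 1, 0] (word_comm 2 0)
    _ = word [0, 1, 0, 2, 1, 3, 2, 0, 1, 0] :=
      word_congr [0, 1, 0, 2] [2, 0, 1, 0] (word_comm 3 1)
    _ = word [1, 0, 1, 2, 1, 3, 2, 0, 1, 0] :=
      word_congr [] [2, 1, 3, 2, 0, 1, 0] (word_braid 0 1)
    _ = word [1, 0, 2, 1, 2, 3, 2, 0, 1, 0] :=
      word_congr [1, 0] [3, 2, 0, 1, 0] (word_braid 1 2)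
    _ = word [1, 0, 2, 1, 3, 2, 3, 0, 1, 0] :=
      word_congr [1, 0, 2, 1] [0, 1, 0] (word_braid 2 3)
    _ = word [1, 0, 2, 3, 1, 2, 3, 0, 1, 0] :=
      word_congr [1, 0, 2] [2, 3, 0, 1, 0] (word_comm 1 3)
    _ = word [1, 0, 2, 3, 1, 2, 3, 1, 0, 1] :=
      word_congr [1, 0, 2, 3, 1, 2, 3] [] (word_braid 0 1)
    _ = word [1, 0, 2, 3, 1, 2, 1, 3, 0, 1] :=
      word_congr [1, 0, 2, 3, 1, 2] [0, 1] (word_comm 3 1)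
    _ = word [1, 0, 2, 3, 2, 1, 2, 3, 0, 1] :=
      word_congr [1, 0, 2, 3] [3, 0, 1] (word_braid 1 2)
    _ = word [1, 0, 3, 2, 3, 1, 2, 3, 0, 1] :=
      word_congr [1, 0] [1, 2, 3, 0, 1] (word_braid 2 3)

theorem pre_s3_mul_s4_mul_s1_mul_s2 : Pre (word [2, 3, 0, 1]) Δ := by
  refine pre_of_word_append_eq (v := [2, 3, 0, 1, 2, 0]) (Eq.symm ?_)
  calc
    Δ = word [0, 1, 2, 3, 0, 1, 2, 0, 1, 0] := Δ_eq_word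
    _ = word [0, 1, 2, 3, 0, 1, 0, 2, 1, 0] :=
      word_congr [0, 1, 2, 3, 0, 1] [1, 0] (word_comm 2 0)
    _ = word [0, 1, 2, 3, 1, 0, 1, 2, 1, 0] :=
      word_congr [0, 1, 2, 3] [2, 1, 0] (word_braid 0 1)
    _ = word [0, 1, 2, 1, 3, 0, 1, 2, 1, 0] :=
      word_congr [0, 1, 2] [0, 1, 2, 1, 0] (word_comm 3 1)
    _ = word [0, 2, 1, 2, 3, 0, 1, 2, 1, 0] :=
      word_congr [0] [3, 0, 1, 2, 1, 0] (word_braid 1 2)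
    _ = word [2, 0, 1, 2, 3, 0, 1, 2, 1, 0] :=
      word_congr [] [1, 2, 3, 0, 1, 2, 1, 0] (word_comm 0 2)
    _ = word [2, 0, 1, 2, 3, 0, 2, 1, 2, 0] :=
      word_congr [2, 0, 1, 2, 3, 0] [0] (word_braid 1 2)
    _ = word [2, 0, 1, 2, 3, 2, 0, 1, 2, 0] :=
      word_congr [2, 0, 1, 2, 3] [1, 2, 0] (word_comm 0 2)
    _ = word [2, 0, 1, 3, 2, 3, 0, 1, 2, 0] :=
      word_congr [2, 0, 1] [0, 1, 2, 0] (word_braid 2 3)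
    _ = word [2, 0, 3, 1, 2, 3, 0, 1, 2, 0] :=
      word_congr [2, 0] [2, 3, 0, 1, 2, 0] (word_comm 1 3)
    _ = word [2, 3, 0, 1, 2, 3, 0, 1, 2, 0] :=
      word_congr [2] [1, 2, 3, 0, 1, 2, 0] (word_comm 0 3)

/-! ### Permutations, exponent sums, and left-weightedness -/

/-- The adjacent transposition underlying a generator. -/
def adjSwap (i : Fin 4) : Equiv.Perm (Fin 5) := Equiv.swap i.castSucc i.succ

/-- The permutation underlying a braid. -/
def permHom : B5 →* Equiv.Perm (Fin 5) :=
  PresentedGroup.toGroup (f := adjSwap) (by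
    rintro r (⟨i, rfl⟩ | ⟨i, j, h, rfl⟩)
    · simp only [map_mul, map_inv, FreeGroup.lift_apply_of]
      revert i
      decide
    · simp only [map_mul, map_inv, FreeGroup.lift_apply_of]
      revert i j
      decide)

@[simp] theorem permHom_gen (i : Fin 4) : permHom (gen i) = adjSwap i :=
  PresentedGroup.toGroup.of _

/-- The exponent sum of a braid. -/
def expSum : B5 →* Multiplicative ℤ :=
  PresentedGroup.toGroup (f := fun _ => Multiplicative.ofAdd 1) (by
    rintro r (⟨_, rfl⟩ | ⟨_, _, _, rfl⟩) <;> simp)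

@[simp] theorem expSum_gen (i : Fin 4) : expSum (gen i) = Multiplicative.ofAdd 1 :=
  PresentedGroup.toGroup.of _

/-- The number of inversions of a permutation of `Fin 5`. -/
def invCount (f : Equiv.Perm (Fin 5)) : ℕ :=
  ∑ a : Fin 5, ∑ b : Fin 5, if a < b ∧ f b < f a then 1 else 0

theorem invCount_mul_adjSwap_le :
    ∀ (f : Equiv.Perm (Fin 5)) (i : Fin 4), invCount (f * adjSwap i) ≤ invCount f + 1 := by
  decide +kernel

theorem invCount_mul_le {x : B5} (hx : IsPos x) :
    ∀ f : Equiv.Perm (Fin 5), (invCount (f * permHom x) : ℤ) ≤ invCount f + (expSum x).toAdd := by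
  induction hx using Submonoid.closure_induction with
  | mem x hx =>
    obtain ⟨i, rfl⟩ := hx
    intro f
    simpa using mod_cast invCount_mul_adjSwap_le f i
  | one => simp
  | mul x y _ _ hx hy =>
    intro f
    have h1 := hx f
    have h2 := hy (f * permHom x)
    rw [map_mul, map_mul, ← mul_assoc, toAdd_mul]
    linarith

/-- The permutation spelled by a word in the adjacent transpositions. -/
def wordPerm (u : List (Fin 4)) : Equiv.Perm (Fin 5) := (u.map adjSwap).prod

theorem permHom_word (u : List (Fin 4)) : permHom (word u) = wordPerm u := by
  simp [word, wordPerm, map_list_prod, Function.comp_def]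

theorem expSum_word (u : List (Fin 4)) : (expSum (word u)).toAdd = (u.length : ℤ) := by
  induction u with
  | nil => simp
  | cons a u ih => simp [ih, add_comm]

theorem IsSimple.invCount_eq {s : B5} (hs : IsSimple s) :
    (invCount (permHom s) : ℤ) = (expSum s).toAdd := by
  have h1 := invCount_mul_le hs.1 1
  have h2 := invCount_mul_le hs.2 (permHom s)
  rw [← map_mul, mul_inv_cancel_left, map_mul, toAdd_mul, map_inv, toAdd_inv, Δ_eq_word,
    expSum_word, permHom_word] at h2
  have h3 : invCount 1 = 0 := by decide
  have h4 : invCount (wordPerm [0, 1, 2, 3, 0, 1, 2, 0, 1, 0]) = 10 := by decide +kernel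
  rw [h4] at h2
  rw [h3, one_mul] at h1
  simp only [List.length_cons, List.length_nil] at h2
  push_cast at h1 h2
  linarith

/-- No generator can be moved from the second word to the first one with both permutation lengths
changing by one: a decidable certificate for left-weightedness. -/
def WeightedWords (u v : List (Fin 4)) : Prop :=
  ∀ i : Fin 4, invCount (wordPerm u * adjSwap i) ≠ u.length + 1 ∨
    invCount (adjSwap i * wordPerm v) + 1 ≠ v.length

instance (u v : List (Fin 4)) : Decidable (WeightedWords u v) :=
  inferInstanceAs (Decidable (∀ _ : Fin 4, _ ∨ _))

theorem WeightedWords.leftWeighted {u v : List (Fin 4)} (h : WeightedWords u v) :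
    LeftWeighted (word u) (word v) := by
  rintro ⟨i, h1, h2⟩
  replace h1 := h1.invCount_eq
  replace h2 := h2.invCount_eq
  have h3 : (adjSwap i)⁻¹ = adjSwap i := Equiv.swap_inv _ _
  simp only [map_mul, map_inv, toAdd_mul, toAdd_inv, permHom_gen, expSum_gen, permHom_word,
    expSum_word, toAdd_ofAdd, h3] at h1 h2
  rcases h i with h | h <;> omega

theorem word_ne_one {u : List (Fin 4)} (h : u.length ≠ 0) : word u ≠ 1 := by
  intro e
  have := expSum_word u
  rw [e, map_one, toAdd_one] at this
  omega

theorem word_ne_Δ {u : List (Fin 4)} (h : u.length ≠ 10) : word u ≠ Δ := by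
  intro e
  have := expSum_word u
  rw [e, Δ_eq_word, expSum_word] at this
  simp only [List.length_cons, List.length_nil] at this
  omega

/-! ### The factors as words -/

/-- The word spelling `aGen`. -/
def aWord : Fin 2 → Fin 2 → List (Fin 4)
  | 0, 0 => [0]
  | 0, 1 => [0, 1]
  | 1, 0 => [1, 0]
  | 1, 1 => [1]

/-- The word spelling `Δ₃ a⁻¹` (`odd = false`) or `a⁻¹ Δ₃` (`odd = true`) for `a = aGen p q`. -/
def aCompl : Bool → Fin 2 → Fin 2 → List (Fin 4)
  | false, 0, 0 => [0, 1]
  | false, 0, 1 => [1]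
  | false, 1, 0 => [0]
  | false, 1, 1 => [1, 0]
  | true, 0, 0 => [1, 0]
  | true, 0, 1 => [0]
  | true, 1, 0 => [1]
  | true, 1, 1 => [0, 1]

theorem word_aWord (p q : Fin 2) : word (aWord p q) = aGen p q := by
  fin_cases p <;> fin_cases q <;> simp [aWord, aGen, s1, s2]

theorem s1_s2_braid : s1 * s2 * s1 = s2 * s1 * s2 := gen_braid 0

theorem word_aCompl_false_mul (p q : Fin 2) : word (aCompl false p q) * aGen p q = Δ3 := by
  have := s1_s2_braid
  fin_cases p <;> fin_cases q <;> simp_all [aCompl, aGen, s1, s2, Δ3, mul_assoc]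

theorem mul_word_aCompl_true (p q : Fin 2) : aGen p q * word (aCompl true p q) = Δ3 := by
  have := s1_s2_braid
  fin_cases p <;> fin_cases q <;> simp_all [aCompl, aGen, s1, s2, Δ3, mul_assoc]

theorem s1_comm_s4 : Commute s1 s4 := gen_comm 0 3 (by decide)

theorem s2_comm_s4 : Commute s2 s4 := gen_comm 1 3 (by decide)

theorem aGen_comm {x : B5} (h1 : Commute s1 x) (h2 : Commute s2 x) (p q : Fin 2) :
    Commute (aGen p q) x := by
  fin_cases p <;> fin_cases q
  exacts [h1, h1.mul_left h2, h2.mul_left h1, h2]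

theorem Δ3_comm_s4 : Commute Δ3 s4 := (s2_comm_s4.mul_left s1_comm_s4).mul_left s2_comm_s4

theorem s1_mul_Δ3 : s1 * Δ3 = Δ3 * s2 := by
  rw [Δ3, ← mul_assoc, ← mul_assoc, s1_s2_braid]

theorem s2_mul_Δ3 : s2 * Δ3 = Δ3 * s1 := by
  simpa [Δ3, mul_assoc] using (congrArg (s2 * ·) s1_s2_braid).symm

theorem s1_comm_Δ3_sq : Commute s1 (Δ3 ^ 2) := by
  rw [Commute, SemiconjBy, pow_two, ← mul_assoc, s1_mul_Δ3, mul_assoc, s2_mul_Δ3, mul_assoc]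

theorem s2_comm_Δ3_sq : Commute s2 (Δ3 ^ 2) := by
  rw [Commute, SemiconjBy, pow_two, ← mul_assoc, s2_mul_Δ3, mul_assoc, s1_mul_Δ3, mul_assoc]

theorem aGen_comm_Δ3_pow {n : ℕ} (hn : Even n) (p q : Fin 2) : Commute (aGen p q) (Δ3 ^ n) := by
  obtain ⟨m, rfl⟩ := hn.two_dvd
  rw [pow_mul]
  exact (aGen_comm s1_comm_Δ3_sq s2_comm_Δ3_sq p q).pow_right m

theorem Δ3_sq : Δ3 ^ 2 = δ3 ^ 3 := by
  have h : Δ3 = δ3 * s2 := rfl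
  have h' : s2 * Δ3 = δ3 * δ3 := by
    rw [Δ3, ← s1_s2_braid, δ3]
    simp only [mul_assoc]
  rw [pow_two]
  nth_rw 1 [h]
  rw [mul_assoc, h', pow_succ' δ3 2, pow_two]

theorem conj_letter_eq_word (n : ℕ) (p q : Fin 2) :
    Δ3 ^ (n + 1) * (aGen p q)⁻¹ * (Δ3 ^ n)⁻¹ = word (aCompl (decide (Odd n)) p q) := by
  rcases Nat.even_or_odd n with hn | hn
  · have h := word_aCompl_false_mul p q
    have hc := aGen_comm_Δ3_pow hn p q
    rw [decide_eq_false (Nat.not_odd_iff_even.2 hn), pow_succ', mul_assoc Δ3,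
      ← hc.inv_left.eq, mul_assoc, mul_inv_cancel_right, ← h, mul_inv_cancel_right]
  · have h := mul_word_aCompl_true p q
    have hc := aGen_comm_Δ3_pow hn.add_one p q
    rw [decide_eq_true hn, ← hc.inv_left.eq, pow_succ', mul_assoc, mul_inv_cancel_right, ← h,
      inv_mul_cancel_left]

/-- The index `i_n`, with the convention `i₀ = 1`. -/
def idx (i : ℕ → Fin 2) (n : ℕ) : Fin 2 := if n = 0 then 0 else i (n - 1)

theorem letter_eq (i : ℕ → Fin 2) (n : ℕ) : letter i n = aGen (idx i n) (idx i (n + 1)) := rfl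

/-- The word spelling `Δ₃ ^ (l + 1) a⁻¹ Δ₃ ^ (-l) σ₄` for `a = letter i l`. -/
def complFactor (i : ℕ → Fin 2) (l : ℕ) : List (Fin 4) :=
  aCompl (decide (Odd l)) (idx i l) (idx i (l + 1)) ++ [3]

/-- The word spelling `σ₄ a` for `a = letter i l`. -/
def letterFactor (i : ℕ → Fin 2) (l : ℕ) : List (Fin 4) :=
  3 :: aWord (idx i l) (idx i (l + 1))

theorem word_complFactor (i : ℕ → Fin 2) (l : ℕ) :
    word (complFactor i l) = Δ3 ^ (l + 1) * (letter i l)⁻¹ * (Δ3 ^ l)⁻¹ * s4 := by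
  rw [complFactor, word_append, ← conj_letter_eq_word, letter_eq]
  simp [s4]

theorem word_letterFactor (i : ℕ → Fin 2) (l : ℕ) :
    word (letterFactor i l) = s4 * letter i l := by
  rw [letterFactor, word_cons, word_aWord, letter_eq, s4]

/-- The factors of the normal form, as words, when `2 * k - 2 = n + 1`. -/
def nfWords (i : ℕ → Fin 2) (n : ℕ) : List (List (Fin 4)) :=
  [[1, 0, 1, 3], [1, 0, 1, 3]] ++
    List.ofFn (fun t : Fin (n + 1) => complFactor i (n - t)) ++
    [[1, 0, 3, 2, 3], [2, 3] ++ aWord 0 (i 0)] ++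
    List.ofFn (fun t : Fin n => letterFactor i (t + 1))

theorem map_word_nfWords (i : ℕ → Fin 2) (n : ℕ) :
    (nfWords i n).map word = [Δ3*s4, Δ3*s4] ++
        List.ofFn (fun t : Fin (n + 1) =>
          Δ3 ^ (n + 1 - (t:ℕ)) * (letter i (n - (t:ℕ)))⁻¹ * (Δ3 ^ (n - (t:ℕ)))⁻¹ * s4) ++
        [δ3*s4*s3*s4, s3*s4*letter i 0] ++
        List.ofFn (fun t : Fin n => s4 * letter i ((t:ℕ)+1)) := by
  have h (t : Fin (n + 1)) : n + 1 - (t : ℕ) = n - t + 1 := Nat.sub_add_comm (Nat.lt_succ_iff.1 t.2)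
  have h0 : letter i 0 = aGen 0 (i 0) := rfl
  simp only [nfWords, List.map_append, List.map_cons, List.map_nil, List.map_ofFn,
    Function.comp_def, h, word_append, word_cons, word_nil, word_aWord, word_complFactor,
    word_letterFactor, h0, Δ3, δ3, s1, s2, s3, s4, mul_assoc, mul_one]

/-! ### Simplicity and left-weightedness of the factors -/

theorem isSimple_complFactor (i : ℕ → Fin 2) (l : ℕ) : IsSimple (word (complFactor i l)) := by
  have key (p q : Fin 2) : IsSimple (word (aCompl false p q ++ [3])) := by
    refine isSimple_word_of_append (v := aWord p q) pre_Δ3_mul_s4 ?_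
    have h := (aGen_comm s1_comm_s4 s2_comm_s4 p q).eq
    rw [word_append, word_append, word_aWord, word_cons, word_nil, mul_one, ← s4, mul_assoc, ← h,
      ← mul_assoc, word_aCompl_false_mul]
    simp [Δ3, s1, s2, s4, mul_assoc]
  have swap : ∀ p q : Fin 2, aCompl true p q = aCompl false (1 - p) (1 - q) := by decide
  rw [complFactor]
  cases decide (Odd l)
  · exact key _ _
  · rw [swap]
    exact key _ _

theorem isSimple_letterFactor (i : ℕ → Fin 2) (l : ℕ) : IsSimple (word (letterFactor i l)) := by
  refine isSimple_word_of_append (v := aCompl true (idx i l) (idx i (l + 1))) pre_Δ3_mul_s4 ?_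
  rw [word_append, word_letterFactor, letter_eq, mul_assoc, mul_word_aCompl_true, ← Δ3_comm_s4.eq]
  simp [Δ3, s1, s2, s4, mul_assoc]

theorem isSimple_s3_mul_s4_mul_aGen (q : Fin 2) : IsSimple (word ([2, 3] ++ aWord 0 q)) := by
  fin_cases q
  · exact isSimple_word_of_append (v := [1]) pre_s3_mul_s4_mul_s1_mul_s2 rfl
  · exact isSimple_word_of_append (v := []) pre_s3_mul_s4_mul_s1_mul_s2 rfl

theorem length_aCompl_lt : ∀ b p q, (aCompl b p q).length < 3 := by decide

theorem length_aWord_lt : ∀ p q, (aWord p q).length < 3 := by decide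

theorem isSimple_of_mem_nfWords {i : ℕ → Fin 2} {n : ℕ} {u : List (Fin 4)}
    (hu : u ∈ nfWords i n) : IsSimple (word u) ∧ u.length ≠ 0 ∧ u.length ≠ 10 := by
  simp only [nfWords, List.mem_append, List.mem_cons, List.not_mem_nil, or_false,
    List.mem_ofFn] at hu
  rcases hu with (((rfl | rfl) | ⟨t, rfl⟩) | rfl | rfl) | ⟨t, rfl⟩
  · exact ⟨⟨isPos_word _, pre_Δ3_mul_s4⟩, by decide⟩
  · exact ⟨⟨isPos_word _, pre_Δ3_mul_s4⟩, by decide⟩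
  · have := length_aCompl_lt (decide (Odd (n - t : ℕ))) (idx i (n - t)) (idx i (n - t + 1))
    refine ⟨isSimple_complFactor _ _, ?_⟩
    rw [complFactor, List.length_append, List.length_singleton]
    omega
  · exact ⟨⟨isPos_word _, pre_δ3_mul_s4_mul_s3_mul_s4⟩, by decide⟩
  · have := length_aWord_lt 0 (i 0)
    refine ⟨isSimple_s3_mul_s4_mul_aGen _, ?_⟩
    rw [List.length_append, List.length_cons, List.length_singleton]
    omega
  · have := length_aWord_lt (idx i (t + 1)) (idx i (t + 1 + 1))
    refine ⟨isSimple_letterFactor _ _, ?_⟩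
    rw [letterFactor, List.length_cons]
    omega

theorem ofFn_sub_succ {α : Type*} (g : ℕ → α) (n : ℕ) :
    List.ofFn (fun t : Fin (n + 1) => g (n - t)) =
      g n :: List.ofFn (fun t : Fin n => g (n - 1 - t)) := by
  rw [List.ofFn_succ]
  congr 2
  funext t
  rw [Fin.val_succ, Nat.sub_sub, Nat.add_comm]

theorem isChain_cons_ofFn_sub {α : Type*} {R : α → α → Prop} {g : ℕ → α} {L : List α}
    (h : ∀ t, R (g (t + 1)) (g t)) (hL : List.IsChain R (g 0 :: L)) (n : ℕ) :
    ∀ a, R a (g n) → List.IsChain R (a :: (List.ofFn (fun t : Fin (n + 1) => g (n - t)) ++ L)) := by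
  induction n with
  | zero => exact fun a ha => by simpa [ha] using hL
  | succ n ih =>
    intro a ha
    rw [ofFn_sub_succ, List.cons_append, List.isChain_cons_cons]
    exact ⟨ha, ih _ (h n)⟩

theorem isChain_cons_ofFn {α : Type*} {R : α → α → Prop} (n : ℕ) :
    ∀ (g : ℕ → α) (a : α), R a (g 0) → (∀ t, R (g t) (g (t + 1))) →
      List.IsChain R (a :: List.ofFn (fun t : Fin n => g t)) := by
  induction n with
  | zero => simp
  | succ n ih =>
    intro g a ha h
    rw [List.ofFn_succ, List.isChain_cons_cons]
    exact ⟨ha, ih (fun t => g (t + 1)) _ (h 0) fun t => h (t + 1)⟩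

theorem isChain_nfWords (i : ℕ → Fin 2) (n : ℕ) : List.IsChain WeightedWords (nfWords i n) := by
  have start : WeightedWords [1, 0, 1, 3] [1, 0, 1, 3] := by decide +kernel
  have start_compl : ∀ b p q, WeightedWords [1, 0, 1, 3] (aCompl b p q ++ [3]) := by
    decide +kernel
  have compl_compl : ∀ b p q r, WeightedWords (aCompl (!b) p q ++ [3]) (aCompl b r p ++ [3]) := by
    decide +kernel
  have compl_mid : ∀ q, WeightedWords (aCompl false 0 q ++ [3]) [1, 0, 3, 2, 3] := by
    decide +kernel
  have mid_mid : ∀ q, WeightedWords [1, 0, 3, 2, 3] ([2, 3] ++ aWord 0 q) := by decide +kernel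
  have mid_letter : ∀ q r, WeightedWords ([2, 3] ++ aWord 0 q) (3 :: aWord q r) := by
    decide +kernel
  have letter_letter : ∀ p q r, WeightedWords (3 :: aWord p q) (3 :: aWord q r) := by
    decide +kernel
  have e : nfWords i n = [1, 0, 1, 3] :: [1, 0, 1, 3] ::
      (List.ofFn (fun t : Fin (n + 1) => complFactor i (n - t)) ++
        ([1, 0, 3, 2, 3] :: ([2, 3] ++ aWord 0 (i 0)) ::
          List.ofFn (fun t : Fin n => letterFactor i (t + 1)))) := by
    simp [nfWords]
  rw [e, List.isChain_cons_cons]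
  refine ⟨start, isChain_cons_ofFn_sub (g := complFactor i) (fun t => ?_) ?_ n _
    (start_compl _ _ _)⟩
  · have hb : decide (Odd (t + 1)) = !decide (Odd t) := by
      rw [← decide_not, decide_eq_decide, Nat.odd_add_one]
    rw [complFactor, complFactor, hb]
    exact compl_compl _ _ _ _
  · rw [List.isChain_cons_cons, List.isChain_cons_cons]
    exact ⟨compl_mid _, mid_mid _, isChain_cons_ofFn n (fun t => letterFactor i (t + 1)) _
      (mid_letter _ _) fun t => letter_letter _ _ _⟩

/-! ### The product of the factors -/

theorem seqWord_comm {x : B5} (h1 : Commute s1 x) (h2 : Commute s2 x) (i : ℕ → Fin 2) (n : ℕ) :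
    Commute (seqWord i n) x := by
  induction n with
  | zero => exact Commute.one_left x
  | succ n ih => exact ih.mul_left (aGen_comm h1 h2 _ _)

theorem prod_compl_factors (i : ℕ → Fin 2) (n : ℕ) :
    (List.ofFn (fun t : Fin n => word (complFactor i (n - 1 - t)))).prod =
      Δ3 ^ n * (seqWord i n)⁻¹ * s4 ^ n := by
  induction n with
  | zero => simp [seqWord]
  | succ n ih =>
    have hs : Commute (Δ3 ^ n * (seqWord i n)⁻¹) s4 :=
      (Δ3_comm_s4.pow_left n).mul_left (seqWord_comm s1_comm_s4 s2_comm_s4 i n).inv_left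
    rw [Nat.add_sub_cancel, ofFn_sub_succ fun l => word (complFactor i l), List.prod_cons, ih,
      word_complFactor, pow_succ' s4, mul_assoc _ s4, ← mul_assoc s4, ← hs.eq, seqWord]
    group

theorem prod_letter_factors (i : ℕ → Fin 2) (n : ℕ) :
    letter i 0 * (List.ofFn (fun t : Fin n => word (letterFactor i (t + 1)))).prod =
      s4 ^ n * seqWord i (n + 1) := by
  induction n with
  | zero => simp [seqWord]
  | succ n ih =>
    have hs := (seqWord_comm s1_comm_s4 s2_comm_s4 i (n + 1)).eq
    rw [List.ofFn_succ_last, List.prod_append, ← mul_assoc]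
    simp only [Fin.val_castSucc, Fin.val_last, List.prod_singleton, word_letterFactor] at ih ⊢
    rw [ih, ← mul_assoc, mul_assoc (s4 ^ n), hs, seqWord.eq_2 i (n + 1), pow_succ]
    group

theorem Tki_eq_prod (i : ℕ → Fin 2) (m : ℕ) :
    Tki (m + 2) i = ((nfWords i (2 * m + 1)).map word).prod := by
  have h1 := prod_compl_factors i (2 * m + 2)
  have h2 := prod_letter_factors i (2 * m + 1)
  have h3 : s3 * s4 * s3 = s4 * s3 * s4 := gen_braid 2
  have h4 : (word [1, 0, 1, 3]) = Δ3 * s4 := by simp [Δ3, s1, s2, s4, mul_assoc]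
  have h5 : word [1, 0, 3, 2, 3] = δ3 * s4 * s3 * s4 := by simp [δ3, s1, s2, s3, s4, mul_assoc]
  have h6 : word ([2, 3] ++ aWord 0 (i 0)) = s3 * s4 * letter i 0 := by
    rw [word_append, word_aWord]
    simp [s3, s4, letter]
  have e1 : 2 * (m + 2) - 2 = 2 * m + 2 := by omega
  have e2 : 2 * (m + 2) - 1 = 2 * m + 3 := by omega
  have e3 : 2 * m + 2 - 1 = 2 * m + 1 := by omega
  rw [e3] at h1
  simp only [nfWords, List.map_append, List.map_cons, List.map_nil, List.map_ofFn,
    Function.comp_def, List.prod_append, List.prod_cons, List.prod_nil, mul_one, h1, h4, h5, h6]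
  rw [Tki, T, e1, e2]
  set w := seqWord i (2 * m + 2)
  have c1 : Commute (Δ3 ^ (2 * m + 2) * w⁻¹) (s4 ^ 2) :=
    ((Δ3_comm_s4.pow_left _).mul_left
      (seqWord_comm s1_comm_s4 s2_comm_s4 i _).inv_left).pow_right 2
  have c2 : Commute δ3 (s4 ^ (2 * m + 4)) := (s2_comm_s4.mul_left s1_comm_s4).pow_right _
  have c3 : Commute w⁻¹ (Δ3 ^ (2 * (m + 2))) := by
    rw [pow_mul]
    exact (seqWord_comm s1_comm_Δ3_sq s2_comm_Δ3_sq i _).inv_left.pow_right _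
  symm
  calc
    _ = Δ3 * (s4 * Δ3) * s4 * (Δ3 ^ (2 * m + 2) * w⁻¹) * s4 ^ (2 * m + 2) * δ3 * s4 *
        (s3 * s4 * s3) * s4 * (letter i 0 *
          (List.ofFn (fun t : Fin (2 * m + 1) => word (letterFactor i (t + 1)))).prod) := by
      simp only [mul_assoc]
    _ = Δ3 ^ 2 * (s4 ^ 2 * (Δ3 ^ (2 * m + 2) * w⁻¹)) * s4 ^ (2 * m + 2) * δ3 * s4 *
        (s4 * s3 * s4) * s4 * (s4 ^ (2 * m + 1) * w) := by
      rw [h2, h3, ← Δ3_comm_s4.eq]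
      simp only [pow_two, mul_assoc]
    _ = Δ3 ^ (2 * (m + 2)) * w⁻¹ * (s4 ^ (2 * m + 4) * δ3) * s4 ^ 2 * s3 * s4 ^ (2 * m + 3) * w := by
      rw [← c1.eq, pow_two s4]
      group
    _ = _ := by
      rw [← c2.eq, ← c3.eq, pow_mul, Δ3_sq, ← pow_mul]
      group

/-- the displayed factorization of `T_{k,i₁,…,i_{2k-2}}` is its left
normal form: the identity
`T_{k,i} = (Δ₃σ₄)² ⋅ (∂₃^{-(2l+1)}(a_{i_l,i_{l+1}})σ₄)_{l=2k-3,…,0} ⋅ (δ₃σ₄σ₃σ₄) ⋅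
(σ₃σ₄a_{1,i₁}) ⋅ (σ₄a_{i₁,i₂}) ⋯ (σ₄a_{i_{2k-3},i_{2k-2}})` holds, where
`∂₃^{-(2l+1)}(x) = Δ₃^{l+1} x⁻¹ Δ₃^{-l}`, each factor is a simple braid distinct
from `1` and `Δ`, and consecutive factors are left-weighted. -/
theorem Tki_left_normal_form (k : ℕ) (hk : 2 ≤ k) (i : ℕ → Fin 2) :
    Tki k i = ([Δ3*s4, Δ3*s4] ++
        List.ofFn (fun t : Fin (2*k-2) =>
          Δ3 ^ (2*k-2-(t:ℕ)) * (letter i (2*k-3-(t:ℕ)))⁻¹ * (Δ3 ^ (2*k-3-(t:ℕ)))⁻¹ * s4) ++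
        [δ3*s4*s3*s4, s3*s4*letter i 0] ++
        List.ofFn (fun t : Fin (2*k-3) => s4 * letter i ((t:ℕ)+1))).prod ∧
    (∀ f ∈ [Δ3*s4, Δ3*s4] ++
        List.ofFn (fun t : Fin (2*k-2) =>
          Δ3 ^ (2*k-2-(t:ℕ)) * (letter i (2*k-3-(t:ℕ)))⁻¹ * (Δ3 ^ (2*k-3-(t:ℕ)))⁻¹ * s4) ++
        [δ3*s4*s3*s4, s3*s4*letter i 0] ++
        List.ofFn (fun t : Fin (2*k-3) => s4 * letter i ((t:ℕ)+1)),
      IsSimple f ∧ f ≠ 1 ∧ f ≠ Δ) ∧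
    List.Chain' LeftWeighted ([Δ3*s4, Δ3*s4] ++
        List.ofFn (fun t : Fin (2*k-2) =>
          Δ3 ^ (2*k-2-(t:ℕ)) * (letter i (2*k-3-(t:ℕ)))⁻¹ * (Δ3 ^ (2*k-3-(t:ℕ)))⁻¹ * s4) ++
        [δ3*s4*s3*s4, s3*s4*letter i 0] ++
        List.ofFn (fun t : Fin (2*k-3) => s4 * letter i ((t:ℕ)+1))) := by
  obtain ⟨m, rfl⟩ := Nat.exists_eq_add_of_le' hk
  have e1 : 2 * (m + 2) - 2 = 2 * m + 1 + 1 := by omega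
  have e2 : 2 * (m + 2) - 3 = 2 * m + 1 := by omega
  rw [e1, e2, ← map_word_nfWords]
  refine ⟨Tki_eq_prod i m, ?_, ?_⟩
  · intro f hf
    obtain ⟨u, hu, rfl⟩ := List.mem_map.1 hf
    obtain ⟨h, h0, h10⟩ := isSimple_of_mem_nfWords hu
    exact ⟨h, word_ne_one h0, word_ne_Δ h10⟩
  · exact (List.isChain_map word).2 <|
      (isChain_nfWords i _).imp fun _ _ h => h.leftWeighted
end

section
/- Let k ≥ 2. The map from {1,2}^{2k−2} to B₅ sending (i₁,…,i_{2k−2}) to T_{k,i₁,…,i_{2k−2}} = w⁻¹ T_k w, where w = a_{1,i₁} a_{i₁,i₂} ⋯ a_{i_{2k−3},i_{2k−2}}, is injective: T_{k,i₁,…,i_{2k−2}} = T_{k,j₁,…,j_{2k−2}} implies i₁ = j₁, …, i_{2k−2} = j_{2k−2}. -/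
open Matrix

/-- The block-diagonal embedding `A ↦ diag(A, I₂)` of `2 × 2` matrices in `4 × 4` matrices. -/
def blockEmb : Matrix (Fin 2) (Fin 2) ℤ →* Matrix (Fin 4) (Fin 4) ℤ where
  toFun A := !![A 0 0, A 0 1, 0, 0; A 1 0, A 1 1, 0, 0; 0, 0, 1, 0; 0, 0, 0, 1]
  map_one' := by decide
  map_mul' A B := by
    ext i j
    fin_cases i <;> fin_cases j <;> simp [Matrix.mul_apply, Fin.sum_univ_succ]

/-- The block-diagonal embedding of `SL₂(ℤ)` in the units of `4 × 4` integer matrices. -/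
def slEmb : SpecialLinearGroup (Fin 2) ℤ →* (Matrix (Fin 4) (Fin 4) ℤ)ˣ :=
  (Units.map blockEmb).comp SpecialLinearGroup.toGL

lemma coe_slEmb (A : SpecialLinearGroup (Fin 2) ℤ) :
    (slEmb A : Matrix (Fin 4) (Fin 4) ℤ) =
      !![A 0 0, A 0 1, 0, 0; A 1 0, A 1 1, 0, 0; 0, 0, 1, 0; 0, 0, 0, 1] := rfl

/-- The image of `σ₁` in `SL₂(ℤ)`. -/
def slOne : SpecialLinearGroup (Fin 2) ℤ := ⟨!![1, 1; 0, 1], by decide⟩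

/-- The image of `σ₂` in `SL₂(ℤ)`. -/
def slTwo : SpecialLinearGroup (Fin 2) ℤ := ⟨!![1, 0; -1, 1], by decide⟩

lemma coe_slOne : (slOne : Matrix (Fin 2) (Fin 2) ℤ) = !![1, 1; 0, 1] := rfl

lemma coe_slTwo : (slTwo : Matrix (Fin 2) (Fin 2) ℤ) = !![1, 0; -1, 1] := rfl

/-- The image of `σ₃` in the integral (`t = -1`) Burau representation. -/
def burauThree : (Matrix (Fin 4) (Fin 4) ℤ)ˣ where
  val := !![1, 1, 0, -1; 0, 1, 0, 0; 0, -1, 1, 1; 0, 0, 0, 1]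
  inv := !![1, -1, 0, 1; 0, 1, 0, 0; 0, 1, 1, -1; 0, 0, 0, 1]
  val_inv := by decide
  inv_val := by decide

/-- The image of `σ₄` in the integral (`t = -1`) Burau representation. -/
def burauFour : (Matrix (Fin 4) (Fin 4) ℤ)ˣ where
  val := !![1, 0, 0, 0; 0, 1, 0, 0; 0, 0, 1, 0; 0, 0, -1, 1]
  inv := !![1, 0, 0, 0; 0, 1, 0, 0; 0, 0, 1, 0; 0, 0, 1, 1]
  val_inv := by decide
  inv_val := by decide

/-- The images of the Artin generators in the reduced Burau representation at `t = -1`, written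
in the basis `c₁, c₂, c₁ + c₃, c₄`, where the generators are transvections along the `cᵢ`. -/
def burauGen : Fin 4 → (Matrix (Fin 4) (Fin 4) ℤ)ˣ :=
  ![slEmb slOne, slEmb slTwo, burauThree, burauFour]

lemma burauGen_braid (i : Fin 3) :
    burauGen i.castSucc * burauGen i.succ * burauGen i.castSucc =
      burauGen i.succ * burauGen i.castSucc * burauGen i.succ := by
  rw [Units.ext_iff]
  revert i
  decide

lemma burauGen_comm (i j : Fin 4) (h : 2 ≤ |(i : ℤ) - (j : ℤ)|) :
    burauGen i * burauGen j = burauGen j * burauGen i := by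
  rw [Units.ext_iff]
  revert i j
  decide

/-- The reduced Burau representation of `B₅` at `t = -1`. -/
def burau : B5 →* (Matrix (Fin 4) (Fin 4) ℤ)ˣ :=
  PresentedGroup.toGroup (f := burauGen) (by
    rintro r (⟨i, rfl⟩ | ⟨i, j, hij, rfl⟩)
    · simpa only [map_mul, map_inv, FreeGroup.lift_apply_of, mul_inv_eq_one] using
        burauGen_braid i
    · simpa only [map_mul, map_inv, FreeGroup.lift_apply_of, mul_inv_eq_one] using
        burauGen_comm i j hij)

lemma burau_gen (i : Fin 4) : burau (gen i) = burauGen i :=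
  PresentedGroup.toGroup.of _

lemma burau_s1 : burau s1 = slEmb slOne := burau_gen 0

lemma burau_s2 : burau s2 = slEmb slTwo := burau_gen 1

lemma burau_s3 : burau s3 = burauThree := burau_gen 2

lemma burau_s4 : burau s4 = burauFour := burau_gen 3

/-- The images of the braids `a_{x,y}` in `SL₂(ℤ)`. -/
def slLetter : Fin 2 → Fin 2 → SpecialLinearGroup (Fin 2) ℤ
  | 0, 0 => slOne
  | 0, 1 => slOne * slTwo
  | 1, 0 => slTwo * slOne
  | 1, 1 => slTwo

lemma burau_aGen (x y : Fin 2) : burau (aGen x y) = slEmb (slLetter x y) := by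
  fin_cases x <;> fin_cases y <;> simp [aGen, slLetter, burau_s1, burau_s2]

/-- The image in `SL₂(ℤ)` of the word of length `n` along the path `x, i 0, i 1, …`. -/
def slPath (x : Fin 2) (i : ℕ → Fin 2) : ℕ → SpecialLinearGroup (Fin 2) ℤ
  | 0 => 1
  | n + 1 => slLetter x (i 0) * slPath (i 0) (fun t => i (t + 1)) n

lemma slPath_succ_last (x : Fin 2) (i : ℕ → Fin 2) (n : ℕ) :
    slPath x i (n + 1) = slPath x i n * slLetter (if n = 0 then x else i (n - 1)) (i n) := by
  induction n generalizing x i with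
  | zero => simp [slPath]
  | succ n ih =>
    rw [slPath, ih, slPath, mul_assoc]
    cases n <;> simp

lemma burau_seqWord (i : ℕ → Fin 2) (n : ℕ) :
    burau (seqWord i n) = slEmb (slPath 0 i n) := by
  induction n with
  | zero => simp [seqWord, slPath]
  | succ n ih => rw [seqWord, map_mul, ih, letter, burau_aGen, slPath_succ_last, map_mul]

/-- The slope condition satisfied by the columns of path words starting at `x`. -/
def InCone (x : Fin 2) (a b : ℤ) : Prop := if x = 0 then 0 ≤ a * b else a * b ≤ 0

lemma slOne_mul_apply_zero (M : SpecialLinearGroup (Fin 2) ℤ) (c : Fin 2) :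
    (slOne * M) 0 c = M 0 c + M 1 c := by
  simp [coe_slOne, Matrix.mul_apply, Fin.sum_univ_two]

lemma slOne_mul_apply_one (M : SpecialLinearGroup (Fin 2) ℤ) (c : Fin 2) :
    (slOne * M) 1 c = M 1 c := by
  simp [coe_slOne, Matrix.mul_apply, Fin.sum_univ_two]

lemma slTwo_mul_apply_zero (M : SpecialLinearGroup (Fin 2) ℤ) (c : Fin 2) :
    (slTwo * M) 0 c = M 0 c := by
  simp [coe_slTwo, Matrix.mul_apply, Fin.sum_univ_two]

lemma slTwo_mul_apply_one (M : SpecialLinearGroup (Fin 2) ℤ) (c : Fin 2) :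
    (slTwo * M) 1 c = M 1 c - M 0 c := by
  simp [coe_slTwo, Matrix.mul_apply, Fin.sum_univ_two]
  ring

lemma inCone_slLetter_mul (x y : Fin 2) (M : SpecialLinearGroup (Fin 2) ℤ) (c : Fin 2)
    (h : InCone y (M 0 c) (M 1 c)) :
    InCone x ((slLetter x y * M) 0 c) ((slLetter x y * M) 1 c) := by
  fin_cases x <;> fin_cases y <;> simp only [InCone, Fin.zero_eta, Fin.mk_one, if_true,
    one_ne_zero, if_false, slLetter, mul_assoc, slOne_mul_apply_zero, slOne_mul_apply_one,
    slTwo_mul_apply_zero, slTwo_mul_apply_one] at h ⊢ <;> nlinarith [sq_nonneg (M 0 c), sq_nonneg (M 1 c)]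

lemma inCone_slPath (x : Fin 2) (i : ℕ → Fin 2) (n : ℕ) (c : Fin 2) :
    InCone x (slPath x i n 0 c) (slPath x i n 1 c) := by
  induction n generalizing x i with
  | zero => fin_cases x <;> fin_cases c <;> simp [InCone, slPath]
  | succ n ih => exact inCone_slLetter_mul _ _ _ _ (ih _ _)

/-- Words starting with `a_{x,1}` and `a_{x,2}` have different images: a common column would lie
on the line shared by the two cones, so the determinant would vanish. -/
lemma slLetter_mul_ne (x : Fin 2) (M N : SpecialLinearGroup (Fin 2) ℤ)
    (hM : ∀ c, InCone 0 (M 0 c) (M 1 c)) (hN : ∀ c, InCone 1 (N 0 c) (N 1 c)) :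
    slLetter x 0 * M ≠ slLetter x 1 * N := by
  intro h
  have hdet := M.det_coe
  rw [Matrix.det_fin_two] at hdet
  have key : ∀ c, M (if x = 0 then 0 else 1) c = 0 := by
    intro c
    have h0 : (slLetter x 0 * M) 0 c = (slLetter x 1 * N) 0 c := by rw [h]
    have h1 : (slLetter x 0 * M) 1 c = (slLetter x 1 * N) 1 c := by rw [h]
    have hMc := hM c
    have hNc := hN c
    fin_cases x <;> simp only [InCone, Fin.zero_eta, Fin.mk_one, if_true, one_ne_zero, if_false,
      slLetter, mul_assoc, slOne_mul_apply_zero, slOne_mul_apply_one, slTwo_mul_apply_zero,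
      slTwo_mul_apply_one] at h0 h1 hMc hNc ⊢
    · rw [show N 0 c = M 0 c by linarith, show N 1 c = M 0 c + M 1 c by linarith] at hNc
      exact pow_eq_zero_iff two_ne_zero |>.1 (by nlinarith [sq_nonneg (M 0 c)])
    · rw [show N 0 c = M 0 c + M 1 c by linarith, show N 1 c = M 1 c by linarith] at hNc
      exact pow_eq_zero_iff two_ne_zero |>.1 (by nlinarith [sq_nonneg (M 1 c)])
  have k0 := key 0
  have k1 := key 1
  split_ifs at k0 k1 <;> simp [k0, k1] at hdet

lemma slPath_injective (x : Fin 2) (i j : ℕ → Fin 2) (n : ℕ)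
    (h : slPath x i n = slPath x j n) : ∀ t < n, i t = j t := by
  induction n generalizing x i j with
  | zero => simp
  | succ n ih =>
    have hi := inCone_slPath (i 0) (fun t => i (t + 1)) n
    have hj := inCone_slPath (j 0) (fun t => j (t + 1)) n
    rw [slPath, slPath] at h
    have h0 : i 0 = j 0 := by
      by_contra hne
      obtain ⟨h0, h1⟩ | ⟨h0, h1⟩ : i 0 = 0 ∧ j 0 = 1 ∨ i 0 = 1 ∧ j 0 = 0 := by omega
      · rw [h0] at h hi
        rw [h1] at h hj
        exact slLetter_mul_ne x _ _ hi hj h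
      · rw [h0] at h hi
        rw [h1] at h hj
        exact slLetter_mul_ne x _ _ hj hi h.symm
    rw [h0] at h
    intro t ht
    cases t with
    | zero => exact h0
    | succ t => exact ih _ _ _ (mul_left_cancel h) t (by omega)

lemma slTwo_mul_slOne_pow (k : ℕ) :
    ((slTwo * slOne) ^ (3 * k + 1)) = (-1) ^ k * (slTwo * slOne) := by
  have h : (slTwo * slOne) ^ 3 = -1 := by decide
  rw [pow_succ, pow_mul, h]

/-- An element of the `σ₁, σ₂` block commuting with `D σ₃` is trivial: the
commutation relation forces it to fix both `c₁` and `D c₁`. -/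
lemma eq_one_of_commute (A D : SpecialLinearGroup (Fin 2) ℤ)
    (hD : D 1 0 ≠ 0)
    (h : Commute (slEmb A) (slEmb D * burauThree)) : A = 1 := by
  have h' : ∀ i j, (slEmb A * (slEmb D * burauThree) : Matrix (Fin 4) (Fin 4) ℤ) i j =
      (slEmb D * burauThree * slEmb A : Matrix (Fin 4) (Fin 4) ℤ) i j := by
    intro i j
    exact congrArg (fun X : (Matrix (Fin 4) (Fin 4) ℤ)ˣ => X.val i j) h
  have e10 := h' 1 0
  have e20 := h' 2 0
  have e21 := h' 2 1
  have e03 := h' 0 3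
  simp [coe_slEmb, burauThree, Matrix.mul_apply, Fin.sum_univ_succ] at e10 e20 e21 e03
  rw [e20, ← e21] at e10
  have hA : A 0 0 = 1 := by
    apply mul_left_cancel₀ hD
    linarith
  have hA' : A 0 1 = 0 := by
    apply mul_right_cancel₀ hD
    rw [hA] at e03
    linarith
  ext i j
  fin_cases i <;> fin_cases j <;> simp [hA, hA', e20, ← e21]

lemma commute_slEmb_burauFour (A : SpecialLinearGroup (Fin 2) ℤ) :
    Commute (slEmb A) burauFour := by
  rw [Commute, SemiconjBy, Units.ext_iff]
  ext i j
  fin_cases i <;> fin_cases j <;>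
    simp [coe_slEmb, burauFour, Matrix.mul_apply, Fin.sum_univ_succ]

/-- the map `(i₁,…,i_{2k-2}) ↦ T_{k,i₁,…,i_{2k-2}}` is injective:
if `T_{k,i} = T_{k,j}` then the two sequences agree in their first `2k-2` entries. -/
theorem Tki_injective (k : ℕ) (hk : 2 ≤ k) (i j : ℕ → Fin 2)
    (h : Tki k i = Tki k j) : ∀ t, t < 2*k-2 → i t = j t := by
  apply slPath_injective 0
  generalize hn : 2 * k - 2 = n
  set A := slPath 0 i n * (slPath 0 j n)⁻¹
  set D := (slTwo * slOne) ^ (3 * k + 1)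
  have hT : burau (T k) =
      slEmb D * burauFour ^ (2 * k + 2) * burauThree * burauFour ^ (2 * k - 1) := by
    simp [T, δ3, D, burau_s1, burau_s2, burau_s3, burau_s4]
  have hcomm : Commute (slEmb A) (burau (T k)) := by
    have := congrArg burau h
    simp only [Tki, map_mul, map_inv, burau_seqWord, hn] at this
    rw [map_mul, map_inv, Commute, SemiconjBy]
    rw [mul_assoc _ (burau (T k)), inv_mul_eq_iff_eq_mul] at this
    rw [← mul_assoc (burau (T k)), this]
    group
  have hX := commute_slEmb_burauFour
  have hDT : slEmb D * burauThree =
      (burauFour ^ (2 * k + 2))⁻¹ * burau (T k) * (burauFour ^ (2 * k - 1))⁻¹ := by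
    rw [hT, ((hX D).pow_right _).eq]
    group
  have hA : A = 1 := by
    refine eq_one_of_commute A D ?_ ?_
    · simp only [D, slTwo_mul_slOne_pow]
      rcases neg_one_pow_eq_or (SpecialLinearGroup (Fin 2) ℤ) k with hk | hk <;> rw [hk] <;> decide
    · rw [hDT]
      exact (((hX A).pow_right _).inv_right.mul_right hcomm).mul_right
        ((hX A).pow_right _).inv_right
  exact mul_inv_eq_one.1 hA
end
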